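/- Let k ≤ m ≤ n and let r be a natural number with μ_k(m) ≥ r. Then μ_k(n) ≥ r · C(n,k)/C(m,k). -/

import Mathlib

open Finset

/-- A finite set of points in the plane is in *general position* if no three of
its points are collinear. -/
def GenPos (P : Finset (ℝ × ℝ)) : Prop :=
  ∀ x ∈ P, ∀ y ∈ P, ∀ z ∈ P, x ≠ y → x ≠ z → y ≠ z →
    ¬ Collinear ℝ ({x, y, z} : Set (ℝ × ℝ))

/-- A finite set of points is in *convex position* if every point of it is an
extreme point of its convex hull. -/
def ConvexPos (S : Finset (ℝ × ℝ)) : Prop :=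
  ∀ x ∈ S, x ∈ Set.extremePoints ℝ (convexHull ℝ (S : Set (ℝ × ℝ)))

open scoped Classical in
/-- Number of `k`-element subsets of `P` that are in convex position. -/
noncomputable def convexPosCount (P : Finset (ℝ × ℝ)) (k : ℕ) : ℕ :=
  ((P.powersetCard k).filter fun S => ConvexPos S).card

/-- `mu k n` is the minimum number of `k`-element subsets in convex position over
all placements of `n` points in general position. -/
noncomputable def mu (k n : ℕ) : ℕ :=
  sInf {m | ∃ P : Finset (ℝ × ℝ), GenPos P ∧ P.card = n ∧ convexPosCount P k = m}

/-- `x` is a γ-point of `T` if `T ∪ {x}` is in convex position. -/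
def IsGammaPt (T : Finset (ℝ × ℝ)) (x : ℝ × ℝ) : Prop :=
  ConvexPos (insert x T)

/-- `x` is a β-point of `T` if `T ∪ {x}` is not in convex position and `x` does not
lie in the convex hull of `T`. -/
def IsBetaPt (T : Finset (ℝ × ℝ)) (x : ℝ × ℝ) : Prop :=
  ¬ ConvexPos (insert x T) ∧ x ∉ convexHull ℝ (T : Set (ℝ × ℝ))

open scoped Classical in
/-- `γ_T`: number of γ-points of `T` among the points of `P \ T`. -/
noncomputable def gammaCount (P T : Finset (ℝ × ℝ)) : ℕ :=
  ((P \ T).filter fun x => IsGammaPt T x).card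

open scoped Classical in
/-- `β_T`: number of β-points of `T` among the points of `P \ T`. -/
noncomputable def betaCount (P T : Finset (ℝ × ℝ)) : ℕ :=
  ((P \ T).filter fun x => IsBetaPt T x).card

open scoped Classical in
/-- Number of `k`-element subsets of `P` whose convex hull has exactly `j`
extreme points. -/
noncomputable def hullCount (P : Finset (ℝ × ℝ)) (k j : ℕ) : ℕ :=
  ((P.powersetCard k).filter fun S =>
    (Set.extremePoints ℝ (convexHull ℝ (S : Set (ℝ × ℝ)))).ncard = j).card

/-- `x` and `y` lie strictly on the same side of the line through `p` and `q`. -/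
def SameSide (p q x y : ℝ × ℝ) : Prop :=
  0 < ((q.1 - p.1) * (x.2 - p.2) - (q.2 - p.2) * (x.1 - p.1)) *
      ((q.1 - p.1) * (y.2 - p.2) - (q.2 - p.2) * (y.1 - p.1))

/-- `x` and `y` lie in the same region with respect to `T`: for each pair of
distinct points of `T`, they lie strictly on the same side of the line through them. -/
def SameRegion (T : Finset (ℝ × ℝ)) (x y : ℝ × ℝ) : Prop :=
  ∀ p ∈ T, ∀ q ∈ T, p ≠ q → SameSide p q x y

open scoped Classical in
/-- Number of 2-element subsets `{x, y}` of `P \ T` such that `x` and `y` are both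
γ-points of `T` lying in the same region with respect to `T`. -/
noncomputable def gammaSamePairs (P T : Finset (ℝ × ℝ)) : ℕ :=
  (((P \ T).powersetCard 2).filter fun S =>
    (∀ x ∈ S, IsGammaPt T x) ∧ ∀ x ∈ S, ∀ y ∈ S, x ≠ y → SameRegion T x y).card

open scoped Classical in
/-- Number of 2-element subsets `{x, y}` of `P \ T` such that `x` and `y` are both
γ-points of `T` lying in distinct regions with respect to `T`. -/
noncomputable def gammaDiffPairs (P T : Finset (ℝ × ℝ)) : ℕ :=
  (((P \ T).powersetCard 2).filter fun S =>
    (∀ x ∈ S, IsGammaPt T x) ∧ ∀ x ∈ S, ∀ y ∈ S, x ≠ y → ¬ SameRegion T x y).card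

open scoped Classical in
/-- Number of 2-element subsets `{x, y}` of `P \ T` such that `x` and `y` are both
β-points of `T` lying in the same region with respect to `T`. -/
noncomputable def betaSamePairs (P T : Finset (ℝ × ℝ)) : ℕ :=
  (((P \ T).powersetCard 2).filter fun S =>
    (∀ x ∈ S, IsBetaPt T x) ∧ ∀ x ∈ S, ∀ y ∈ S, x ≠ y → SameRegion T x y).card

open scoped Classical in
/-- Number of 2-element subsets `{x, y}` of `P \ T` such that `x` and `y` are both
β-points of `T` lying in distinct regions with respect to `T`. -/
noncomputable def betaDiffPairs (P T : Finset (ℝ × ℝ)) : ℕ :=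
  (((P \ T).powersetCard 2).filter fun S =>
    (∀ x ∈ S, IsBetaPt T x) ∧ ∀ x ∈ S, ∀ y ∈ S, x ≠ y → ¬ SameRegion T x y).card

lemma GenPos.subset {P Q : Finset (ℝ × ℝ)} (hP : GenPos P) (hQ : Q ⊆ P) : GenPos Q :=
  fun x hx y hy z hz => hP x (hQ hx) y (hQ hy) z (hQ hz)

/-- Three distinct points of the parabola `y = x ^ 2` are not collinear. -/
lemma not_collinear_parabola {a b c : ℝ} (hab : a ≠ b) (hac : a ≠ c) (hbc : b ≠ c) :
    ¬ Collinear ℝ ({(a, a ^ 2), (b, b ^ 2), (c, c ^ 2)} : Set (ℝ × ℝ)) := by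
  rw [collinear_iff_exists_forall_eq_smul_vadd]
  rintro ⟨p, v, h⟩
  obtain ⟨s, hs⟩ := h (a, a ^ 2) (by simp)
  obtain ⟨t, ht⟩ := h (b, b ^ 2) (by simp)
  obtain ⟨u, hu⟩ := h (c, c ^ 2) (by simp)
  simp only [Prod.ext_iff, vadd_eq_add, Prod.fst_add, Prod.snd_add, Prod.smul_fst,
    Prod.smul_snd, smul_eq_mul] at hs ht hu
  have hb₁ : b - a = (t - s) * v.1 := by linear_combination ht.1 - hs.1
  have hb₂ : b ^ 2 - a ^ 2 = (t - s) * v.2 := by linear_combination ht.2 - hs.2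
  have hc₁ : c - a = (u - s) * v.1 := by linear_combination hu.1 - hs.1
  have hc₂ : c ^ 2 - a ^ 2 = (u - s) * v.2 := by linear_combination hu.2 - hs.2
  have hdet : (b - a) * (c ^ 2 - a ^ 2) - (c - a) * (b ^ 2 - a ^ 2) = 0 := by
    rw [hb₁, hb₂, hc₁, hc₂]
    ring
  have hprod : (b - a) * (c - a) * (c - b) ≠ 0 :=
    mul_ne_zero (mul_ne_zero (sub_ne_zero.2 hab.symm) (sub_ne_zero.2 hac.symm))
      (sub_ne_zero.2 hbc.symm)
  exact hprod (by linear_combination hdet)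

/-- There are point placements of every size. -/
lemma exists_genPos_card_eq (n : ℕ) : ∃ P : Finset (ℝ × ℝ), GenPos P ∧ P.card = n := by
  classical
  refine ⟨(range n).image fun i : ℕ => ((i : ℝ), (i : ℝ) ^ 2), ?_, ?_⟩
  · intro x hx y hy z hz hxy hxz hyz
    obtain ⟨i, -, rfl⟩ := mem_image.1 hx
    obtain ⟨j, -, rfl⟩ := mem_image.1 hy
    obtain ⟨l, -, rfl⟩ := mem_image.1 hz
    exact not_collinear_parabola (fun h => hxy (by simp only [h]))
      (fun h => hxz (by simp only [h])) (fun h => hyz (by simp only [h]))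
  · rw [card_image_of_injective _ fun i j h => Nat.cast_injective (Prod.ext_iff.1 h).1,
      card_range]

lemma mu_le_convexPosCount {P : Finset (ℝ × ℝ)} (hP : GenPos P) (k : ℕ) :
    mu k P.card ≤ convexPosCount P k :=
  Nat.sInf_le ⟨P, hP, rfl, rfl⟩

lemma exists_convexPosCount_eq_mu (k n : ℕ) :
    ∃ P : Finset (ℝ × ℝ), GenPos P ∧ P.card = n ∧ convexPosCount P k = mu k n := by
  obtain ⟨P, hP, hn⟩ := exists_genPos_card_eq n
  exact Nat.sInf_mem (s := {m | ∃ P : Finset (ℝ × ℝ), GenPos P ∧ P.card = n ∧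
    convexPosCount P k = m}) ⟨_, P, hP, hn, rfl⟩

/-- Double counting of the pairs `S ⊆ Q ⊆ P` with `S` a `k`-subset in convex position and
`Q` an `m`-subset. -/
lemma choose_mul_mu_le {P : Finset (ℝ × ℝ)} (hP : GenPos P) {k m : ℕ} (hkm : k ≤ m) :
    P.card.choose m * mu k m ≤ convexPosCount P k * (P.card - k).choose (m - k) := by
  classical
  have h := card_nsmul_le_card_nsmul' (R := ℕ)
    (s := (P.powersetCard k).filter fun S => ConvexPos S) (t := P.powersetCard m)
    (fun S Q : Finset (ℝ × ℝ) => S ⊆ Q) (n := mu k m) (m := (P.card - k).choose (m - k)) ?_ ?_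
  · rw [card_powersetCard, smul_eq_mul, smul_eq_mul] at h
    unfold convexPosCount
    convert! h
  · intro Q hQ
    obtain ⟨hQP, rfl⟩ := mem_powersetCard.1 hQ
    refine (mu_le_convexPosCount (hP.subset hQP) k).trans (card_le_card fun S hS => ?_)
    obtain ⟨hS, hconv⟩ := mem_filter.1 hS
    obtain ⟨hSQ, hk⟩ := mem_powersetCard.1 hS
    exact mem_filter.2 ⟨mem_filter.2 ⟨mem_powersetCard.2 ⟨hSQ.trans hQP, hk⟩, hconv⟩, hSQ⟩
  · intro S hS
    obtain ⟨hSP, rfl⟩ := mem_powersetCard.1 (mem_filter.1 hS).1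
    exact (card_filter_powersetCard_subset S P m hSP hkm).le

/-- Supersaturation: if `k ≤ m ≤ n` and `μ_k(m) ≥ r`, then
`μ_k(n) ≥ r · C(n,k) / C(m,k)`. -/
theorem mu_supersaturation (k m n r : ℕ) (hkm : k ≤ m) (hmn : m ≤ n)
    (hr : mu k m ≥ r) :
    (mu k n : ℝ) ≥ (r : ℝ) * (n.choose k : ℝ) / (m.choose k : ℝ) := by
  obtain ⟨P, hP, rfl, hcount⟩ := exists_convexPosCount_eq_mu k n
  have hle := choose_mul_mu_le hP hkm
  rw [hcount] at hle
  have hpos : 0 < (P.card - k).choose (m - k) := Nat.choose_pos (by omega)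
  rw [ge_iff_le, div_le_iff₀ (by exact_mod_cast Nat.choose_pos hkm)]
  norm_cast
  refine Nat.le_of_mul_le_mul_right ?_ hpos
  calc r * P.card.choose k * (P.card - k).choose (m - k)
      = P.card.choose m * r * m.choose k := by
        rw [mul_assoc, ← Nat.choose_mul hkm]
        ring
    _ ≤ P.card.choose m * mu k m * m.choose k := by gcongr
    _ ≤ mu k P.card * (P.card - k).choose (m - k) * m.choose k := by gcongr
    _ = mu k P.card * m.choose k * (P.card - k).choose (m - k) := by ring
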